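/- Let I be an ideal on ω, X a first countable compact topological space, and x a sequence in X whose set of I-cluster points is the singleton {ℓ}. Then x is I-convergent to ℓ. If moreover I is a P-ideal, then x is I*-convergent to ℓ. -/

import Mathlib

open Filter Topology

/-- An ideal on ω: closed under subsets and finite unions, contains all singletons,
and is not the whole power set. -/
def IsIdeal (I : Set (Set ℕ)) : Prop :=
  (∀ ⦃A B : Set ℕ⦄, A ∈ I → B ⊆ A → B ∈ I) ∧
  (∀ ⦃A B : Set ℕ⦄, A ∈ I → B ∈ I → A ∪ B ∈ I) ∧
  (∀ n : ℕ, ({n} : Set ℕ) ∈ I) ∧ (Set.univ : Set ℕ) ∉ I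

/-- A P-ideal. -/
def IsPIdeal (I : Set (Set ℕ)) : Prop :=
  IsIdeal I ∧ ∀ A : ℕ → Set ℕ, (∀ n, A n ∈ I) → ∃ B ∈ I, ∀ n, (A n \ B).Finite

/-- A G-ideal. -/
def IsGIdeal (I : Set (Set ℕ)) : Prop :=
  IsIdeal I ∧ ∀ a : ℕ → ℕ, StrictMono a → (Set.range a)ᶜ ∈ I →
    ∀ B : Set ℕ, ((a '' B)ᶜ ∈ I ↔ Bᶜ ∈ I)

variable {X : Type*} [TopologicalSpace X]

/-- `I`-convergence of a sequence to a point. -/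
def IConv (I : Set (Set ℕ)) (x : ℕ → X) (l : X) : Prop :=
  ∀ U ∈ 𝓝 l, {n | x n ∉ U} ∈ I

/-- `I*`-convergence: some subsequence indexed by a set of the dual filter converges. -/
def IStarConv (I : Set (Set ℕ)) (x : ℕ → X) (l : X) : Prop :=
  ∃ e : ℕ → ℕ, StrictMono e ∧ (Set.range e)ᶜ ∈ I ∧ Tendsto (x ∘ e) atTop (𝓝 l)

/-- The set of `I`-cluster points of a sequence. -/
def IClusterPts (I : Set (Set ℕ)) (x : ℕ → X) : Set X :=
  {l | ∀ U ∈ 𝓝 l, {n | x n ∈ U} ∉ I}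

/-- The set of `I`-limit points of a sequence. -/
def ILimitPts (I : Set (Set ℕ)) (x : ℕ → X) : Set X :=
  {l | ∃ e : ℕ → ℕ, StrictMono e ∧ Set.range e ∉ I ∧ Tendsto (x ∘ e) atTop (𝓝 l)}

theorem stmt13 {X : Type*} [TopologicalSpace X] [CompactSpace X]
    [FirstCountableTopology X] {I : Set (Set ℕ)} (hI : IsIdeal I)
    {x : ℕ → X} {l : X} (h : IClusterPts I x = {l}) :
    IConv I x l ∧ (IsPIdeal I → IStarConv I x l) := by
  obtain ⟨hsub, hun, hsing, huniv⟩ := hI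
  have hempty : (∅ : Set ℕ) ∈ I := hsub (hsing 0) (Set.empty_subset _)
  have hconv : IConv I x l := by
    intro U hU
    have hK : IsCompact (interior U)ᶜ := isOpen_interior.isClosed_compl.isCompact
    have key : {n | x n ∈ (interior U)ᶜ} ∈ I := by
      refine hK.induction_on (p := fun S => {n | x n ∈ S} ∈ I) ?_ ?_ ?_ ?_
      · simpa using hempty
      · intro s t hst ht
        exact hsub ht (fun n hn => hst hn)
      · intro s t hs ht
        exact hun hs ht
      · intro y hy
        have hne : y ∉ IClusterPts I x := by
          rw [h]
          rintro rfl
          exact hy (mem_interior_iff_mem_nhds.2 hU)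
        simp only [IClusterPts, Set.mem_setOf_eq, not_forall, not_not] at hne
        obtain ⟨V, hV, hVI⟩ := hne
        exact ⟨V, mem_nhdsWithin_of_mem_nhds hV, hVI⟩
    exact hsub key (fun n hn hn' => hn (interior_subset hn'))
  refine ⟨hconv, fun hP => ?_⟩
  obtain ⟨V, hV⟩ := (𝓝 l).exists_antitone_basis
  obtain ⟨B, hB, hfin⟩ := hP.2 (fun k => {n | x n ∉ V k}) (fun k => hconv _ (hV.mem k))
  have hfinI : ∀ s : Set ℕ, s.Finite → s ∈ I := by
    intro s hs
    induction s, hs using Set.Finite.induction_on with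
    | empty => exact hempty
    | insert _ _ ih => exact hun (hsing _) ih
  have hinf : (setOf (fun n => n ∉ B)).Infinite := by
    intro hf
    apply huniv
    have h1 := hun hB (hfinI _ hf)
    exact hsub h1 (fun n _ => Classical.em (n ∈ B))
  refine ⟨Nat.nth (fun n => n ∉ B), Nat.nth_strictMono hinf, ?_, ?_⟩
  · rw [Nat.range_nth_of_infinite hinf]
    exact hsub hB (fun n hn => not_not.1 hn)
  · rw [hV.toHasBasis.tendsto_right_iff]
    intro k _
    rw [← Nat.cofinite_eq_atTop, Filter.eventually_cofinite]
    refine ((hfin k).preimage (Nat.nth_injective hinf).injOn).subset ?_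
    intro m hm
    exact ⟨hm, Nat.nth_mem_of_infinite hinf m⟩
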